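/- arXiv:2111.15431 — 7 statements merged into one kernel-verified Lean document; each statement's English description precedes it below -/
import Mathlib

section
/- Let M = (A, {μ_z^u}_u, {Σ_z^u}_u) be a binary ICA model with n = n_z = 2 and invertible 2×2 mixing matrix A, and let Â be the matrix obtained from A by swapping its two rows. Then there exist mean vectors μ̂_z^u ∈ ℝ² and diagonal positive-definite matrices Σ̂_z^u such that the binary ICA model M̂ = (Â, {μ̂_z^u}_u, {Σ̂_z^u}_u) implies exactly the same probability distribution on the binary observation vector x^u ∈ {0,1}² as M, in every segment u. -/
open MeasureTheory Matrix Real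

/-- Multivariate Gaussian measure on `Fin n → ℝ` with mean `μ` and (positive-definite)
covariance `S`, defined via its density w.r.t. Lebesgue measure. -/
noncomputable def mvGaussian {n : ℕ} (μ : Fin n → ℝ) (S : Matrix (Fin n) (Fin n) ℝ) :
    Measure (Fin n → ℝ) :=
  volume.withDensity fun x =>
    ENNReal.ofReal (Real.sqrt (((2 * Real.pi) ^ n * S.det)⁻¹) *
      Real.exp (-(1 / 2) * ((x - μ) ⬝ᵥ (S⁻¹ *ᵥ (x - μ)))))

/-- The orthant of `ℝ^n` corresponding to a binary assignment `b`:
coordinates with `b i = 1` are negative, the others positive. -/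
def orthant {n : ℕ} (b : Fin n → Bool) : Set (Fin n → ℝ) :=
  {w | ∀ i, if b i then w i < 0 else 0 < w i}

/-- `μ_q = -√(π/8) A μ_z`. -/
noncomputable def muQ {n nz : ℕ} (A : Matrix (Fin n) (Fin nz) ℝ) (μz : Fin nz → ℝ) :
    Fin n → ℝ :=
  (-Real.sqrt (Real.pi / 8)) • (A *ᵥ μz)

/-- `Σ_q = I + (π/8) A Σ_z Aᵀ`. -/
noncomputable def sigmaQ {n nz : ℕ} (A : Matrix (Fin n) (Fin nz) ℝ)
    (Sz : Matrix (Fin nz) (Fin nz) ℝ) : Matrix (Fin n) (Fin n) ℝ :=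
  1 + (Real.pi / 8) • (A * Sz * Aᵀ)

/-- The probability that the binary ICA model with mixing matrix `A`, source means `μz`
and source covariance `Sz` assigns to the binary observation `b`: the probability of the
corresponding orthant under the Gaussian `N(μ_q, Σ_q)`. -/
noncomputable def binProb {n nz : ℕ} (A : Matrix (Fin n) (Fin nz) ℝ) (μz : Fin nz → ℝ)
    (Sz : Matrix (Fin nz) (Fin nz) ℝ) (b : Fin n → Bool) : ENNReal :=
  mvGaussian (muQ A μz) (sigmaQ A Sz) (orthant b)

/-- Correlation matrix of a covariance matrix. -/
noncomputable def corrMat {n : ℕ} (S : Matrix (Fin n) (Fin n) ℝ) :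
    Matrix (Fin n) (Fin n) ℝ :=
  Matrix.of fun i j => S i j / Real.sqrt (S i i * S j j)

/-- The standard normal cumulative distribution function. -/
noncomputable def stdNormalCDF (t : ℝ) : ℝ :=
  ∫ s in Set.Iic t, (Real.sqrt (2 * Real.pi))⁻¹ * Real.exp (-(s ^ 2) / 2)

theorem measurableSet_orthant {n : ℕ} (b : Fin n → Bool) : MeasurableSet (orthant b) := by
  have h : orthant b = ⋂ i, {w : Fin n → ℝ | if b i then w i < 0 else 0 < w i} := by
    ext w
    simp [orthant]
  rw [h]
  refine MeasurableSet.iInter fun i => ?_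
  cases b i
  · simpa using measurableSet_lt measurable_const (measurable_pi_apply i)
  · simpa using measurableSet_lt (measurable_pi_apply i) measurable_const

/-- Rescaling the coordinates by positive factors preserves orthants. -/
theorem diagonal_mulVec_mem_orthant_iff {n : ℕ} {d : Fin n → ℝ} (hd : ∀ i, 0 < d i)
    (b : Fin n → Bool) (x : Fin n → ℝ) :
    diagonal d *ᵥ x ∈ orthant b ↔ x ∈ orthant b := by
  refine forall_congr' fun i => ?_
  rw [mulVec_diagonal]
  cases b i
  · simp [mul_pos_iff_of_pos_left (hd i)]
  · simp [mul_neg_iff, hd i, (hd i).not_gt]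

theorem measurePreserving_diagonal_mulVec {n : ℕ} {d : Fin n → ℝ} (hprod : ∏ i, d i = 1) :
    MeasurePreserving (fun x : Fin n → ℝ => diagonal d *ᵥ x) volume volume := by
  have hdet : (diagonal d).det = 1 := by rw [det_diagonal, hprod]
  refine ⟨(Continuous.matrix_mulVec continuous_const continuous_id).measurable, ?_⟩
  have h := Real.map_matrix_volume_pi_eq_smul_volume_pi (M := diagonal d) (by simp [hdet])
  rw [hdet, inv_one, abs_one, ENNReal.ofReal_one, one_smul] at h
  exact h

/-- Orthant probabilities of a Gaussian are unchanged by a volume-preserving positive diagonal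
rescaling of the coordinates. -/
theorem mvGaussian_diagonal_orthant {n : ℕ} {d : Fin n → ℝ} (hd : ∀ i, 0 < d i)
    (hprod : ∏ i, d i = 1) (μ : Fin n → ℝ) (S : Matrix (Fin n) (Fin n) ℝ) (b : Fin n → Bool) :
    mvGaussian (diagonal d *ᵥ μ) (diagonal d * S * diagonal d) (orthant b)
      = mvGaussian μ S (orthant b) := by
  have hdet : (diagonal d).det = 1 := by rw [det_diagonal, hprod]
  have hunit : IsUnit (diagonal d).det := by simp [hdet]
  have hpre : (fun x : Fin n → ℝ => diagonal d *ᵥ x) ⁻¹' orthant b = orthant b := by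
    ext x
    exact diagonal_mulVec_mem_orthant_iff hd b x
  have hquad (x : Fin n → ℝ) :
      (diagonal d *ᵥ x - diagonal d *ᵥ μ) ⬝ᵥ
          ((diagonal d * S * diagonal d)⁻¹ *ᵥ (diagonal d *ᵥ x - diagonal d *ᵥ μ))
        = (x - μ) ⬝ᵥ (S⁻¹ *ᵥ (x - μ)) := by
    rw [← mulVec_sub, Matrix.mul_inv_rev, Matrix.mul_inv_rev, mulVec_mulVec, Matrix.mul_assoc,
      Matrix.mul_assoc, nonsing_inv_mul _ hunit, Matrix.mul_one, ← mulVec_mulVec,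
      dotProduct_mulVec _ (diagonal d)⁻¹, ← vecMul_transpose, vecMul_vecMul, diagonal_transpose,
      mul_nonsing_inv _ hunit, vecMul_one]
  unfold mvGaussian
  rw [withDensity_apply _ (measurableSet_orthant b), withDensity_apply _ (measurableSet_orthant b),
    ← (measurePreserving_diagonal_mulVec hprod).setLIntegral_comp_preimage
      (measurableSet_orthant b) (by fun_prop), hpre]
  simp only [hquad, det_mul, hdet, one_mul, mul_one]

theorem sigmaQ_posDef {n nz : ℕ} (A : Matrix (Fin n) (Fin nz) ℝ)
    {Sz : Matrix (Fin nz) (Fin nz) ℝ} (hS : Sz.PosSemidef) : (sigmaQ A Sz).PosDef := by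
  refine PosDef.one.add_posSemidef (PosSemidef.smul ?_ (by positivity))
  simpa using hS.mul_mul_conjTranspose_same A

theorem sigmaQ_submatrix {n nz : ℕ} (A : Matrix (Fin n) (Fin nz) ℝ)
    (Sz : Matrix (Fin nz) (Fin nz) ℝ) (e : Equiv.Perm (Fin n)) :
    sigmaQ (A.submatrix e id) Sz = (sigmaQ A Sz).submatrix e e := by
  ext i j
  simp [sigmaQ, Matrix.mul_apply, Matrix.one_apply]

/-- Every vector is a latent mean `muQ A m` when `A` is invertible. -/
theorem exists_muQ_eq {n : ℕ} {A : Matrix (Fin n) (Fin n) ℝ} (hA : IsUnit A.det)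
    (v : Fin n → ℝ) : ∃ m, muQ A m = v := by
  have hc : -Real.sqrt (Real.pi / 8) ≠ 0 := neg_ne_zero.mpr (by positivity)
  refine ⟨(-Real.sqrt (Real.pi / 8))⁻¹ • (A⁻¹ *ᵥ v), ?_⟩
  rw [muQ, mulVec_smul, smul_smul, mul_inv_cancel₀ hc, one_smul, mulVec_mulVec,
    mul_nonsing_inv _ hA, one_mulVec]

/-- Exchanging the coordinates of a covariance matrix on the plane amounts to a volume-preserving
positive diagonal rescaling, since the correlation matrix does not change. -/
theorem exists_diagonal_mul_mul_eq_swap {S : Matrix (Fin 2) (Fin 2) ℝ} (hS : S.PosDef) :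
    ∃ d : Fin 2 → ℝ, (∀ i, 0 < d i) ∧ ∏ i, d i = 1 ∧
      diagonal d * S * diagonal d = S.submatrix (Equiv.swap 0 1) (Equiv.swap 0 1) := by
  have h0 : 0 < S 0 0 := hS.diag_pos
  have h1 : 0 < S 1 1 := hS.diag_pos
  have hsymm : S 1 0 = S 0 1 := by simpa using hS.isHermitian.apply 0 1
  have hr : 0 < √(S 1 1 / S 0 0) := by positivity
  have hr2 : √(S 1 1 / S 0 0) ^ 2 = S 1 1 / S 0 0 := Real.sq_sqrt (by positivity)
  generalize √(S 1 1 / S 0 0) = r at hr hr2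
  have hr3 : r ^ 2 * S 0 0 = S 1 1 := by rw [hr2]; field_simp
  refine ⟨![r, r⁻¹], ?_, ?_, ?_⟩
  · simp [Fin.forall_fin_two, hr]
  · simp [Fin.prod_univ_two, hr.ne']
  · ext i j
    fin_cases i <;> fin_cases j <;> simp [diagonal_mul, mul_diagonal, hsymm] <;> field_simp <;>
      linarith

/-- **Row order indeterminacy (Theorem 1).** If the rows of the 2×2 mixing matrix of a
binary ICA model are swapped, the source means and (diagonal, positive-definite)
variances can be adjusted so that the implied binary distributions are identical in
every segment. -/
theorem row_order_indeterminacy {U : Type*}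
    (A : Matrix (Fin 2) (Fin 2) ℝ) (hA : IsUnit A.det)
    (μz : U → Fin 2 → ℝ) (Sz : U → Matrix (Fin 2) (Fin 2) ℝ)
    (hdiag : ∀ u, (Sz u).IsDiag) (hpos : ∀ u, (Sz u).PosDef) :
    ∃ (μz' : U → Fin 2 → ℝ) (Sz' : U → Matrix (Fin 2) (Fin 2) ℝ),
      (∀ u, (Sz' u).IsDiag) ∧ (∀ u, (Sz' u).PosDef) ∧
      ∀ (u : U) (b : Fin 2 → Bool),
        binProb (A.submatrix (Equiv.swap (0 : Fin 2) 1) id) (μz' u) (Sz' u) b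
          = binProb A (μz u) (Sz u) b := by
  have hA' : IsUnit (A.submatrix (Equiv.swap (0 : Fin 2) 1) id).det := by
    rw [det_permute]
    simpa using hA
  choose d hd hprod hswap using fun u =>
    exists_diagonal_mul_mul_eq_swap (sigmaQ_posDef A (hpos u).posSemidef)
  choose m hm using fun u => exists_muQ_eq hA' (diagonal (d u) *ᵥ muQ A (μz u))
  refine ⟨m, Sz, hdiag, hpos, fun u b => ?_⟩
  rw [binProb, binProb, hm, sigmaQ_submatrix, ← hswap]
  exact mvGaussian_diagonal_orthant (hd u) (hprod u) _ _ b
end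

section
/- Let M and M̂ be two binary ICA models with the same number n ≥ 2 of observed variables, and in a given segment u let q^u ~ N(μ_q^u, Σ_q^u) and q̂^u ~ N(μ̂_q^u, Σ̂_q^u) be the associated Gaussian vectors, with Σ_q^u and Σ̂_q^u positive definite. If the correlation matrix of Σ_q^u differs from the correlation matrix of Σ̂_q^u, then the probability distributions that M and M̂ induce on the binary observation vector x^u ∈ {0,1}^n in segment u are different. -/
open MeasureTheory Matrix Real

open ProbabilityTheory Set

theorem strictAnti_gaussianReal_Ici : StrictAnti fun t : ℝ => gaussianReal 0 1 (Ici t) := by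
  intro s t hst
  have hdisj : Disjoint (Ico s t) (Ici t) := by
    rw [Set.disjoint_left]
    intro x hx hx'
    exact absurd hx.2 (not_lt.mpr hx')
  have hsplit : gaussianReal 0 1 (Ici s) =
      gaussianReal 0 1 (Ico s t) + gaussianReal 0 1 (Ici t) := by
    rw [← measure_union hdisj measurableSet_Ici, Ico_union_Ici_eq_Ici hst.le]
  have hpos : gaussianReal 0 1 (Ico s t) ≠ 0 := fun h0 => by
    have h1 := gaussianReal_absolutelyContinuous' 0 (one_ne_zero (α := NNReal)) h0
    simp [Real.volume_Ico] at h1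
    linarith
  simp only [hsplit]
  rw [add_comm]
  exact ENNReal.lt_add_right (measure_ne_top _ _) hpos

theorem gaussianReal_one_Ici (m t : ℝ) :
    gaussianReal m 1 (Ici t) = gaussianReal 0 1 (Ici (t - m)) := by
  have h := gaussianReal_map_add_const (μ := 0) (v := 1) m
  rw [zero_add] at h
  rw [← h, Measure.map_apply (by fun_prop) measurableSet_Ici]
  congr 1
  ext x
  simp

/-- Single-crossing argument: Gaussian upper tails along two affine functions with different
slopes cannot have equal integrals over both half-lines. -/
theorem slope_le_of_setLIntegral_eq {m a b a' b' : ℝ}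
    (hneg : ∫⁻ x in Iio 0, gaussianReal 0 1 (Ici (a * x + b)) ∂gaussianReal m 1 =
      ∫⁻ x in Iio 0, gaussianReal 0 1 (Ici (a' * x + b')) ∂gaussianReal m 1)
    (hpos : ∫⁻ x in Ici 0, gaussianReal 0 1 (Ici (a * x + b)) ∂gaussianReal m 1 =
      ∫⁻ x in Ici 0, gaussianReal 0 1 (Ici (a' * x + b')) ∂gaussianReal m 1) :
    a' ≤ a := by
  by_contra! haa
  have hmeas : ∀ c d : ℝ, Measurable fun x : ℝ => gaussianReal 0 1 (Ici (c * x + d)) :=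
    fun c d => strictAnti_gaussianReal_Ici.antitone.measurable.comp
      (f := fun x : ℝ => c * x + d) (by fun_prop)
  have hfin : ∀ (c d : ℝ) (s : Set ℝ),
      ∫⁻ x in s, gaussianReal 0 1 (Ici (c * x + d)) ∂gaussianReal m 1 ≠ ⊤ := fun c d s => by
    refine ((setLIntegral_mono (g := fun _ => 1) measurable_const fun x _ => prob_le_one).trans_lt
      ?_).ne
    simp
  have hnull : ∀ s : Set ℝ, volume s ≠ 0 → gaussianReal m 1 s ≠ 0 := fun s hs h0 =>
    hs (gaussianReal_absolutelyContinuous' m (one_ne_zero (α := NNReal)) h0)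
  rcases le_or_gt b' b with hb | hb
  · refine (setLIntegral_strict_mono measurableSet_Iio (hnull _ (by simp)) (hmeas a' b')
      (hfin a b _) (Filter.Eventually.of_forall fun x hx => ?_)).ne hneg
    exact strictAnti_gaussianReal_Ici (by nlinarith [mem_Iio.mp hx])
  · refine (setLIntegral_strict_mono measurableSet_Ici (hnull _ (by simp)) (hmeas a b)
      (hfin a' b' _) (Filter.Eventually.of_forall fun x hx => ?_)).ne hpos.symm
    exact strictAnti_gaussianReal_Ici (by nlinarith [mem_Ici.mp hx])

theorem slope_eq_of_setLIntegral_eq {m a b a' b' : ℝ}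
    (hneg : ∫⁻ x in Iio 0, gaussianReal 0 1 (Ici (a * x + b)) ∂gaussianReal m 1 =
      ∫⁻ x in Iio 0, gaussianReal 0 1 (Ici (a' * x + b')) ∂gaussianReal m 1)
    (hpos : ∫⁻ x in Ici 0, gaussianReal 0 1 (Ici (a * x + b)) ∂gaussianReal m 1 =
      ∫⁻ x in Ici 0, gaussianReal 0 1 (Ici (a' * x + b')) ∂gaussianReal m 1) :
    a = a' :=
  le_antisymm (slope_le_of_setLIntegral_eq hneg.symm hpos.symm)
    (slope_le_of_setLIntegral_eq hneg hpos)

theorem eq_of_div_sqrt_one_sub_sq_eq {r s : ℝ} (hr : r ^ 2 < 1) (hs : s ^ 2 < 1)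
    (h : -r / √(1 - r ^ 2) = -s / √(1 - s ^ 2)) : r = s := by
  have hr' : 0 < √(1 - r ^ 2) := Real.sqrt_pos.mpr (by linarith)
  have hs' : 0 < √(1 - s ^ 2) := Real.sqrt_pos.mpr (by linarith)
  have hr2 := Real.sq_sqrt (show 0 ≤ 1 - r ^ 2 by linarith)
  have hs2 := Real.sq_sqrt (show 0 ≤ 1 - s ^ 2 by linarith)
  rw [div_eq_div_iff hr'.ne' hs'.ne'] at h
  have hsq : r ^ 2 = s ^ 2 := by
    have := congrArg (· ^ 2) h
    simp only [mul_pow, hr2, hs2, neg_sq] at this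
    linarith
  rw [hsq] at h
  exact neg_injective (mul_right_cancel₀ hs'.ne' h)

/-- Conditioning on the first coordinate of a standardized bivariate Gaussian vector. -/
theorem HasGaussianLaw.measure_inter_eq_setLIntegral {Ω : Type*} [MeasurableSpace Ω]
    {P : Measure Ω} {X Y : Ω → ℝ} (hXm : Measurable X) (hYm : Measurable Y)
    (hXY : HasGaussianLaw (fun ω => (X ω, Y ω)) P)
    (hX : cov[X, X; P] = 1) (hY : cov[Y, Y; P] = 1) (hr : cov[X, Y; P] ^ 2 < 1) :
    ∃ b : ℝ, ∀ s : Set ℝ, MeasurableSet s → P {ω | X ω ∈ s ∧ 0 ≤ Y ω} =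
      ∫⁻ x in s, gaussianReal 0 1
        (Ici (-cov[X, Y; P] / √(1 - cov[X, Y; P] ^ 2) * x + b)) ∂gaussianReal P[X] 1 := by
  set r := cov[X, Y; P] with hr_def
  have hq : 0 < √(1 - r ^ 2) := Real.sqrt_pos.mpr (by linarith)
  have hq2 := Real.sq_sqrt (show 0 ≤ 1 - r ^ 2 by linarith)
  set q := √(1 - r ^ 2)
  have := hXY.isProbabilityMeasure
  have hX2 : MemLp X 2 P := hXY.fst.memLp_two
  have hY2 : MemLp Y 2 P := hXY.snd.memLp_two
  let W : Ω → ℝ := fun ω => q⁻¹ * (Y ω - r * X ω)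
  have hXW : HasGaussianLaw (fun ω => (X ω, W ω)) P := by
    simpa [W] using hXY.map_fun ((ContinuousLinearMap.fst ℝ ℝ ℝ).prod
      (q⁻¹ • (ContinuousLinearMap.snd ℝ ℝ ℝ - r • ContinuousLinearMap.fst ℝ ℝ ℝ)))
  have hWm : Measurable W := by fun_prop
  have hrX : MemLp (fun ω => r * X ω) 2 P := hX2.const_mul r
  have hcov : cov[X, W; P] = 0 := by
    simp only [W]
    rw [covariance_const_mul_right, covariance_fun_sub_right hX2 hY2 hrX,
      covariance_const_mul_right, hX, ← hr_def]
    ring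
  have hvar : cov[W, W; P] = 1 := by
    simp only [W]
    rw [covariance_const_mul_right, covariance_const_mul_left,
      covariance_fun_sub_fun_sub hY2 hrX hY2 hrX,
      covariance_const_mul_right, covariance_const_mul_right, covariance_const_mul_left,
      covariance_const_mul_left, covariance_comm Y X, hX, hY, ← hr_def]
    field_simp
    linarith
  have hlawX : P.map X = gaussianReal P[X] 1 := by
    rw [hXW.fst.map_eq_gaussianReal, ← covariance_self hXm.aemeasurable, hX, Real.toNNReal_one]
  have hlawW : P.map W = gaussianReal P[W] 1 := by
    rw [hXW.snd.map_eq_gaussianReal, ← covariance_self hWm.aemeasurable, hvar, Real.toNNReal_one]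
  have hprod := (hXW.indepFun_of_covariance_eq_zero hcov).map_prod_eq_prod_map_map
    hXm.aemeasurable hWm.aemeasurable
  rw [hlawX, hlawW] at hprod
  refine ⟨-P[W], fun s hs => ?_⟩
  let E : Set (ℝ × ℝ) := {p | p.1 ∈ s ∧ -r / q * p.1 ≤ p.2}
  have hE : MeasurableSet E :=
    (measurable_fst hs).inter
      (measurableSet_le (measurable_fst.const_mul (-r / q)) measurable_snd)
  have hpre : {ω | X ω ∈ s ∧ 0 ≤ Y ω} = (fun ω => (X ω, W ω)) ⁻¹' E := by
    ext ω
    simp only [mem_ofPred_eq, mem_preimage, E, W]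
    refine and_congr_right fun _ => ?_
    rw [← div_eq_inv_mul, div_mul_eq_mul_div, div_le_div_iff_of_pos_right hq]
    constructor <;> intro h <;> linarith
  rw [hpre, ← Measure.map_apply (hXm.prodMk hWm) hE, hprod, Measure.prod_apply hE,
    ← lintegral_indicator hs]
  refine lintegral_congr fun x => ?_
  by_cases hx : x ∈ s
  · rw [indicator_of_mem hx, ← sub_eq_add_neg, ← gaussianReal_one_Ici]
    congr 1
    ext y
    simp [E, hx]
  · rw [indicator_of_notMem hx]
    have : Prod.mk x ⁻¹' E = ∅ := by
      ext y
      simp [E, hx]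
    rw [this, measure_empty]

theorem HasGaussianLaw.covariance_eq_of_measure_eq {Ω Ω' : Type*} [MeasurableSpace Ω]
    [MeasurableSpace Ω'] {P : Measure Ω} {P' : Measure Ω'} {X Y : Ω → ℝ} {X' Y' : Ω' → ℝ}
    (hXm : Measurable X) (hYm : Measurable Y)
    (hXY : HasGaussianLaw (fun ω => (X ω, Y ω)) P)
    (hX : cov[X, X; P] = 1) (hY : cov[Y, Y; P] = 1) (hr : cov[X, Y; P] ^ 2 < 1)
    (hXm' : Measurable X') (hYm' : Measurable Y')
    (hXY' : HasGaussianLaw (fun ω => (X' ω, Y' ω)) P')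
    (hX' : cov[X', X'; P'] = 1) (hY' : cov[Y', Y'; P'] = 1) (hr' : cov[X', Y'; P'] ^ 2 < 1)
    (h₁ : P {ω | 0 ≤ X ω} = P' {ω | 0 ≤ X' ω})
    (h₂ : P {ω | X ω < 0 ∧ 0 ≤ Y ω} = P' {ω | X' ω < 0 ∧ 0 ≤ Y' ω})
    (h₃ : P {ω | 0 ≤ X ω ∧ 0 ≤ Y ω} = P' {ω | 0 ≤ X' ω ∧ 0 ≤ Y' ω}) :
    cov[X, Y; P] = cov[X', Y'; P'] := by
  have hlaw : P.map X = gaussianReal P[X] 1 := by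
    rw [hXY.fst.map_eq_gaussianReal, ← covariance_self hXm.aemeasurable, hX, Real.toNNReal_one]
  have hlaw' : P'.map X' = gaussianReal P'[X'] 1 := by
    rw [hXY'.fst.map_eq_gaussianReal, ← covariance_self hXm'.aemeasurable, hX',
      Real.toNNReal_one]
  have hmean : P[X] = P'[X'] := by
    have h : P.map X (Ici 0) = P'.map X' (Ici 0) := by
      rw [Measure.map_apply hXm measurableSet_Ici, Measure.map_apply hXm' measurableSet_Ici]
      exact h₁
    rw [hlaw, hlaw', gaussianReal_one_Ici, gaussianReal_one_Ici P'[X']] at h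
    have := strictAnti_gaussianReal_Ici.injective h
    linarith
  obtain ⟨b, hb⟩ := HasGaussianLaw.measure_inter_eq_setLIntegral hXm hYm hXY hX hY hr
  obtain ⟨b', hb'⟩ := HasGaussianLaw.measure_inter_eq_setLIntegral hXm' hYm' hXY' hX' hY' hr'
  rw [hmean] at hb
  exact eq_of_div_sqrt_one_sub_sq_eq hr hr' <| slope_eq_of_setLIntegral_eq
    ((hb _ measurableSet_Iio).symm.trans (h₂.trans (hb' _ measurableSet_Iio)))
    ((hb _ measurableSet_Ici).symm.trans (h₃.trans (hb' _ measurableSet_Ici)))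

theorem mvGaussian_zero_one (n : ℕ) :
    mvGaussian (0 : Fin n → ℝ) 1 = Measure.pi fun _ => gaussianReal 0 1 := by
  refine (Measure.pi_eq fun s hs => ?_).symm
  have hdens : ∀ x : Fin n → ℝ, √(((2 * π) ^ n * (1 : Matrix (Fin n) (Fin n) ℝ).det)⁻¹) *
      Real.exp (-(1 / 2) * ((x - 0) ⬝ᵥ ((1 : Matrix (Fin n) (Fin n) ℝ)⁻¹ *ᵥ (x - 0)))) =
      ∏ i, gaussianPDFReal 0 1 (x i) := fun x => by
    simp only [gaussianPDFReal, Finset.prod_mul_distrib, ← Real.exp_sum]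
    congr 1
    · have hsqrt : √((2 * π) ^ n) = √(2 * π) ^ n := by
        rw [Real.sqrt_eq_iff_mul_self_eq (by positivity) (by positivity), ← mul_pow,
          Real.mul_self_sqrt (by positivity)]
      rw [det_one, mul_one, Real.sqrt_inv, hsqrt]
      simp only [NNReal.coe_one, mul_one, Finset.prod_const, Finset.card_univ, Fintype.card_fin,
        inv_pow]
    · congr 1
      simp only [sub_zero, inv_one, one_mulVec, dotProduct, Finset.mul_sum]
      refine Finset.sum_congr rfl fun i _ => ?_
      simp
      ring
  rw [mvGaussian, withDensity_apply _ (MeasurableSet.univ_pi hs)]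
  simp_rw [hdens, gaussianReal_apply_eq_integral 0 one_ne_zero]
  rw [volume_pi, Measure.restrict_pi_pi, ← ofReal_integral_eq_lintegral_ofReal,
    integral_fintype_prod_eq_prod (fun _ => gaussianPDFReal 0 1), ENNReal.ofReal_prod_of_nonneg]
  · exact fun i _ => integral_nonneg fun x => gaussianPDFReal_nonneg _ _ _
  · exact Integrable.fintype_prod fun i => (integrable_gaussianPDFReal 0 1).restrict
  · exact Filter.Eventually.of_forall fun x =>
      Finset.prod_nonneg fun i _ => gaussianPDFReal_nonneg _ _ _

theorem mvGaussian_eq_map {n : ℕ} (μ : Fin n → ℝ) {S R : Matrix (Fin n) (Fin n) ℝ}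
    (hS : S = R * Rᵀ) (hR : R.det ≠ 0) :
    mvGaussian μ S = (mvGaussian 0 1).map fun x => μ + R *ᵥ x := by
  have hT : Measurable fun x : Fin n → ℝ => μ + R *ᵥ x := by fun_prop
  have hvol : (volume : Measure (Fin n → ℝ)) =
      ENNReal.ofReal |R.det| • Measure.map (fun x => μ + R *ᵥ x) volume := by
    have h := congrArg (Measure.map (μ + ·)) (Real.map_matrix_volume_pi_eq_smul_volume_pi hR)
    rw [Measure.map_smul, map_add_left_eq_self volume, Measure.map_map (by fun_prop)
      (LinearMap.continuous_on_pi _).measurable] at h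
    change Measure.map (fun x => μ + R *ᵥ x) volume = _ at h
    rw [h, smul_smul, ← ENNReal.ofReal_mul (abs_nonneg _), ← abs_mul, mul_inv_cancel₀ hR,
      abs_one, ENNReal.ofReal_one, one_smul]
  have hquad : ∀ x : Fin n → ℝ, (R *ᵥ x) ⬝ᵥ (S⁻¹ *ᵥ (R *ᵥ x)) = x ⬝ᵥ x := fun x => by
    have hRu : IsUnit R.det := isUnit_iff_ne_zero.mpr hR
    have hRtu : IsUnit Rᵀ.det := by rwa [det_transpose]
    rw [hS, Matrix.mul_inv_rev, mulVec_mulVec, Matrix.mul_assoc, Matrix.nonsing_inv_mul _ hRu,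
      Matrix.mul_one, ← vecMul_transpose, ← dotProduct_mulVec, mulVec_mulVec,
      Matrix.mul_nonsing_inv _ hRtu, one_mulVec]
  have hconst : |R.det| * √(((2 * π) ^ n * S.det)⁻¹) = √(((2 * π) ^ n)⁻¹) := by
    rw [hS, det_mul, det_transpose, mul_inv, Real.sqrt_mul (by positivity), Real.sqrt_inv (_ * _),
      Real.sqrt_mul_self_eq_abs]
    field_simp
  have hmeas : Measurable fun x : Fin n → ℝ => ENNReal.ofReal (√(((2 * π) ^ n * S.det)⁻¹) *
      Real.exp (-(1 / 2) * ((x - μ) ⬝ᵥ (S⁻¹ *ᵥ (x - μ))))) := by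
    simp only [dotProduct]
    fun_prop
  ext s hs
  have hchange : ∀ f : (Fin n → ℝ) → ENNReal, Measurable f → ∫⁻ y in s, f y =
      ∫⁻ x in (fun x => μ + R *ᵥ x) ⁻¹' s, ENNReal.ofReal |R.det| * f (μ + R *ᵥ x) := fun f hf => by
    conv_lhs => rw [hvol]
    rw [Measure.restrict_smul, lintegral_smul_measure, setLIntegral_map hs hf hT, smul_eq_mul,
      lintegral_const_mul' _ _ ENNReal.ofReal_ne_top]
  rw [Measure.map_apply hT hs, mvGaussian, mvGaussian, withDensity_apply _ hs,
    withDensity_apply _ (hT hs), hchange _ hmeas]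
  refine lintegral_congr fun x => ?_
  rw [← ENNReal.ofReal_mul (abs_nonneg _), ← mul_assoc, hconst, add_sub_cancel_left, hquad]
  simp

open scoped MatrixOrder in
theorem mvGaussian_eq_map_multivariateGaussian {n : ℕ} (μ : Fin n → ℝ)
    {S : Matrix (Fin n) (Fin n) ℝ} (hS : S.PosDef) :
    mvGaussian μ S = (multivariateGaussian (WithLp.toLp 2 μ) S).map WithLp.ofLp := by
  have hsq : CFC.sqrt S * CFC.sqrt S = S := CFC.sqrt_mul_sqrt_self _ hS.posSemidef.nonneg
  have htr : (CFC.sqrt S)ᵀ = CFC.sqrt S := by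
    have := (CFC.sqrt_nonneg S).posSemidef.isHermitian
    rwa [IsHermitian, conjTranspose_eq_transpose_of_trivial] at this
  have hdet : (CFC.sqrt S).det ≠ 0 := fun h0 => hS.det_pos.ne' (by
    rw [← hsq, det_mul, h0, zero_mul])
  rw [mvGaussian_eq_map μ (hsq.symm.trans (by rw [htr])) hdet, mvGaussian_zero_one,
    multivariateGaussian, ← map_pi_eq_stdGaussian, Measure.map_map (by fun_prop) (by fun_prop),
    Measure.map_map (by fun_prop) (by fun_prop)]
  rfl

theorem orthant_ae_eq {n : ℕ} (μ : Fin n → ℝ) (S : Matrix (Fin n) (Fin n) ℝ)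
    (b : Fin n → Bool) :
    orthant b =ᵐ[mvGaussian μ S] (fun w i => decide (w i < 0)) ⁻¹' {b} := by
  have hne : ∀ᵐ w ∂mvGaussian μ S, ∀ i, w i ≠ 0 :=
    (withDensity_absolutelyContinuous _ _).ae_le
      (ae_all_iff.mpr fun i => Measure.ae_eval_ne (fun _ => volume) i 0)
  filter_upwards [hne] with w hw
  refine propext ?_
  change (∀ i, if b i then w i < 0 else 0 < w i) ↔ (fun i => decide (w i < 0)) = b
  rw [funext_iff]
  refine forall_congr' fun i => ?_
  cases b i
  · simpa using ⟨le_of_lt, fun h => lt_of_le_of_ne h (hw i).symm⟩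
  · simp

theorem measurable_decide_neg {n : ℕ} :
    Measurable fun (w : Fin n → ℝ) i => decide (w i < 0) :=
  measurable_pi_lambda _ fun i => measurable_to_bool <| by
    simpa [preimage] using measurableSet_lt (measurable_pi_apply i) measurable_const

theorem mvGaussian_preimage_sign_eq {n : ℕ} {μ μ' : Fin n → ℝ} {S S' : Matrix (Fin n) (Fin n) ℝ}
    (h : ∀ b, mvGaussian μ S (orthant b) = mvGaussian μ' S' (orthant b))
    (E : Set (Fin n → Bool)) :
    mvGaussian μ S ((fun w i => decide (w i < 0)) ⁻¹' E) =
      mvGaussian μ' S' ((fun w i => decide (w i < 0)) ⁻¹' E) := by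
  have hmap : (mvGaussian μ S).map (fun w i => decide (w i < 0)) =
      (mvGaussian μ' S').map fun w i => decide (w i < 0) :=
    Measure.ext_of_singleton fun b => by
      rw [Measure.map_apply measurable_decide_neg (measurableSet_singleton b),
        Measure.map_apply measurable_decide_neg (measurableSet_singleton b), ← measure_congr (orthant_ae_eq μ S b),
        ← measure_congr (orthant_ae_eq μ' S' b), h b]
  have := congrArg (· E) hmap
  simpa only [Measure.map_apply measurable_decide_neg E.toFinite.measurableSet] using this

theorem Matrix.PosDef.sq_lt_mul_diag {n : ℕ} {S : Matrix (Fin n) (Fin n) ℝ} (hS : S.PosDef)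
    {i j : Fin n} (hij : i ≠ j) : S i j ^ 2 < S i i * S j j := by
  have hinj : Function.Injective ![i, j] := by
    intro a b
    fin_cases a <;> fin_cases b <;> simp [hij, hij.symm]
  have h := (hS.submatrix hinj).det_pos
  rw [det_fin_two] at h
  have hsymm : S j i = S i j := by simpa using hS.isHermitian.apply i j
  simp [hsymm] at h
  nlinarith

theorem corrMat_sq_lt_one {n : ℕ} {S : Matrix (Fin n) (Fin n) ℝ} (hS : S.PosDef)
    {i j : Fin n} (hij : i ≠ j) : corrMat S i j ^ 2 < 1 := by
  have hd : 0 < S i i * S j j := mul_pos hS.diag_pos hS.diag_pos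
  rw [corrMat, of_apply, div_pow, Real.sq_sqrt hd.le, div_lt_one hd]
  exact hS.sq_lt_mul_diag hij

theorem corrMat_diag {n : ℕ} {S : Matrix (Fin n) (Fin n) ℝ} (hS : S.PosDef) (i : Fin n) :
    corrMat S i i = 1 := by
  have hd : 0 < S i i := hS.diag_pos
  rw [corrMat, of_apply, Real.sqrt_mul_self hd.le, div_self hd.ne']

theorem covariance_div_sqrt_diag {n : ℕ} (μ : EuclideanSpace ℝ (Fin n))
    {S : Matrix (Fin n) (Fin n) ℝ} (hS : S.PosDef) (i j : Fin n) :
    cov[fun x => x i / √(S i i), fun x => x j / √(S j j); multivariateGaussian μ S] =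
      corrMat S i j := by
  simp_rw [div_eq_mul_inv]
  rw [covariance_mul_const_left, covariance_mul_const_right,
    covariance_eval_multivariateGaussian hS.posSemidef, corrMat, of_apply,
    Real.sqrt_mul hS.diag_pos.le, div_eq_mul_inv, mul_inv]
  ring

theorem hasGaussianLaw_div_sqrt_diag {n : ℕ} (μ : EuclideanSpace ℝ (Fin n))
    (S : Matrix (Fin n) (Fin n) ℝ) (i j : Fin n) :
    HasGaussianLaw (fun x => (x i / √(S i i), x j / √(S j j))) (multivariateGaussian μ S) := by
  have h := (IsGaussian.hasGaussianLaw_id (μ := multivariateGaussian μ S)).map_fun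
    (((√(S i i))⁻¹ • (EuclideanSpace.proj i : EuclideanSpace ℝ (Fin n) →L[ℝ] ℝ)).prod
      ((√(S j j))⁻¹ • (EuclideanSpace.proj j : EuclideanSpace ℝ (Fin n) →L[ℝ] ℝ)))
  simpa [div_eq_inv_mul] using h

/-- The orthant probabilities of a nondegenerate Gaussian vector determine its correlations. -/
theorem corrMat_eq_of_mvGaussian_orthant_eq {n : ℕ} {μ μ' : Fin n → ℝ}
    {S S' : Matrix (Fin n) (Fin n) ℝ} (hS : S.PosDef) (hS' : S'.PosDef)
    (h : ∀ b, mvGaussian μ S (orthant b) = mvGaussian μ' S' (orthant b)) :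
    corrMat S = corrMat S' := by
  ext i j
  rcases eq_or_ne i j with rfl | hij
  · rw [corrMat_diag hS, corrMat_diag hS']
  have hpos : ∀ {T : Matrix (Fin n) (Fin n) ℝ}, T.PosDef → ∀ k, 0 < √(T k k) :=
    fun hT k => Real.sqrt_pos.mpr hT.diag_pos
  have hsign : ∀ {ν : Fin n → ℝ} {T : Matrix (Fin n) (Fin n) ℝ}, T.PosDef →
      ∀ E : Set (Fin n → Bool), multivariateGaussian (WithLp.toLp 2 ν) T
        {x | (fun k => decide (x k / √(T k k) < 0)) ∈ E} =
      mvGaussian ν T ((fun w k => decide (w k < 0)) ⁻¹' E) := fun {ν T} hT E => by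
    rw [mvGaussian_eq_map_multivariateGaussian ν hT, Measure.map_apply (by fun_prop)
      (measurable_decide_neg E.toFinite.measurableSet)]
    congr 1
    ext x
    simp [div_neg_iff, hpos hT, (hpos hT _).not_gt]
  have heq : ∀ E : Set (Fin n → Bool), multivariateGaussian (WithLp.toLp 2 μ) S
      {x | (fun k => decide (x k / √(S k k) < 0)) ∈ E} =
      multivariateGaussian (WithLp.toLp 2 μ') S'
        {x | (fun k => decide (x k / √(S' k k) < 0)) ∈ E} := fun E => by
    rw [hsign hS, hsign hS', mvGaussian_preimage_sign_eq h]
  rw [← covariance_div_sqrt_diag (WithLp.toLp 2 μ) hS,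
    ← covariance_div_sqrt_diag (WithLp.toLp 2 μ') hS']
  refine HasGaussianLaw.covariance_eq_of_measure_eq (by fun_prop) (by fun_prop)
    (hasGaussianLaw_div_sqrt_diag _ S i j) ?_ ?_ ?_ (by fun_prop) (by fun_prop)
    (hasGaussianLaw_div_sqrt_diag _ S' i j) ?_ ?_ ?_ ?_ ?_ ?_
  · rw [covariance_div_sqrt_diag _ hS, corrMat_diag hS]
  · rw [covariance_div_sqrt_diag _ hS, corrMat_diag hS]
  · rw [covariance_div_sqrt_diag _ hS]
    exact corrMat_sq_lt_one hS hij
  · rw [covariance_div_sqrt_diag _ hS', corrMat_diag hS']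
  · rw [covariance_div_sqrt_diag _ hS', corrMat_diag hS']
  · rw [covariance_div_sqrt_diag _ hS']
    exact corrMat_sq_lt_one hS' hij
  · simpa using heq {b | b i = false}
  · simpa using heq {b | b i = true ∧ b j = false}
  · simpa using heq {b | b i = false ∧ b j = false}

/-- **Correlation identifiability (Theorem 2).** Two binary ICA models with the same
number `n ≥ 2` of observed variables imply different binary distributions (in a given
segment) if the correlation matrices of their `Σ_q` differ. -/
theorem different_corr_implies_different_distributions {n nz nz' : ℕ} (hn : 2 ≤ n)
    (A : Matrix (Fin n) (Fin nz) ℝ) (hA : LinearIndependent ℝ fun j i => A i j)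
    (μz : Fin nz → ℝ) (Sz : Matrix (Fin nz) (Fin nz) ℝ)
    (hd : Sz.IsDiag) (hp : Sz.PosDef)
    (A' : Matrix (Fin n) (Fin nz') ℝ) (hA' : LinearIndependent ℝ fun j i => A' i j)
    (μz' : Fin nz' → ℝ) (Sz' : Matrix (Fin nz') (Fin nz') ℝ)
    (hd' : Sz'.IsDiag) (hp' : Sz'.PosDef)
    (hq : (sigmaQ A Sz).PosDef) (hq' : (sigmaQ A' Sz').PosDef)
    (hcorr : corrMat (sigmaQ A Sz) ≠ corrMat (sigmaQ A' Sz')) :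
    ∃ b : Fin n → Bool, binProb A μz Sz b ≠ binProb A' μz' Sz' b := by
  by_contra! h
  exact hcorr (corrMat_eq_of_mvGaussian_orthant_eq hq hq' h)
end

section
/- Let M = (A, {μ_z^u}_u, {Σ_z^u}_u) and M̂ = (Â, {μ̂_z^u}_u, {Σ̂_z^u}_u) be two binary ICA models with n = n_z and invertible mixing matrices A and Â. If for every segment u the correlation matrices of Σ_q^u = I + (π/8) A Σ_z^u Aᵀ and Σ̂_q^u = I + (π/8) Â Σ̂_z^u Âᵀ are equal, then there exist adjusted source means μ̃_z^u ∈ ℝ^{n_z} such that the model (Â, {μ̃_z^u}_u, {Σ̂_z^u}_u) implies exactly the same probability distribution on the binary observation vector x^u as M, in every segment u. -/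
open MeasureTheory Matrix Real

/-- Rescaling the coordinates of a Gaussian by a diagonal matrix. -/
theorem mvGaussian_diagonal_apply {n : ℕ} (d : Fin n → ℝ) (hd : ∀ i, 0 < d i) (μ : Fin n → ℝ)
    (S : Matrix (Fin n) (Fin n) ℝ) {s : Set (Fin n → ℝ)} (hs : MeasurableSet s) :
    mvGaussian (diagonal d *ᵥ μ) (diagonal d * S * diagonal d) s =
      mvGaussian μ S ((fun x => diagonal d *ᵥ x) ⁻¹' s) := by
  have hdet : 0 < (diagonal d).det := by
    rw [det_diagonal]
    exact Finset.prod_pos fun i _ => hd i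
  have hunit : IsUnit (diagonal d).det := hdet.ne'.isUnit
  have hquad (x : Fin n → ℝ) :
      (diagonal d *ᵥ x - diagonal d *ᵥ μ) ⬝ᵥ
          ((diagonal d * S * diagonal d)⁻¹ *ᵥ (diagonal d *ᵥ x - diagonal d *ᵥ μ)) =
        (x - μ) ⬝ᵥ (S⁻¹ *ᵥ (x - μ)) := by
    rw [← mulVec_sub, Matrix.mul_inv_rev, Matrix.mul_inv_rev, mulVec_mulVec, Matrix.mul_assoc,
      Matrix.mul_assoc, nonsing_inv_mul _ hunit, Matrix.mul_one, ← mulVec_mulVec]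
    conv_lhs => rw [← diagonal_transpose d, mulVec_transpose, ← dotProduct_mulVec,
      diagonal_transpose, mulVec_mulVec, mul_nonsing_inv _ hunit, one_mulVec]
  have hconst : (diagonal d).det *
        √(((2 * π) ^ n * (diagonal d * S * diagonal d).det)⁻¹) =
      √(((2 * π) ^ n * S.det)⁻¹) := by
    rw [det_mul, det_mul]
    nth_rewrite 1 [← Real.sqrt_sq hdet.le]
    rw [← Real.sqrt_mul (sq_nonneg _)]
    congr 1
    rw [mul_inv, mul_inv, mul_inv, mul_inv]
    field_simp
  have hmeas : Measurable fun x : Fin n → ℝ => diagonal d *ᵥ x :=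
    (Continuous.matrix_mulVec continuous_const continuous_id).measurable
  have hvol : (volume : Measure (Fin n → ℝ)) =
      ENNReal.ofReal (diagonal d).det • Measure.map (fun x => diagonal d *ᵥ x) volume := by
    have h := Real.smul_map_diagonal_volume_pi hdet.ne'
    rw [abs_of_pos hdet] at h
    exact h.symm
  have hdens (ν : Fin n → ℝ) (T : Matrix (Fin n) (Fin n) ℝ) : Measurable fun x : Fin n → ℝ =>
      ENNReal.ofReal (√(((2 * π) ^ n * T.det)⁻¹) *
        Real.exp (-(1 / 2) * ((x - ν) ⬝ᵥ (T⁻¹ *ᵥ (x - ν))))) := by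
    refine (ENNReal.continuous_ofReal.comp ?_).measurable
    fun_prop
  rw [mvGaussian, mvGaussian, withDensity_apply _ hs, withDensity_apply _ (hmeas hs)]
  conv_lhs => rw [hvol]
  rw [Measure.restrict_smul, lintegral_smul_measure, setLIntegral_map hs (hdens _ _) hmeas,
    smul_eq_mul, ← lintegral_const_mul' _ _ ENNReal.ofReal_ne_top]
  refine lintegral_congr fun x => ?_
  rw [hquad, ← ENNReal.ofReal_mul hdet.le, ← mul_assoc, hconst]

theorem preimage_diagonal_orthant {n : ℕ} (d : Fin n → ℝ) (hd : ∀ i, 0 < d i)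
    (b : Fin n → Bool) : (fun x => diagonal d *ᵥ x) ⁻¹' orthant b = orthant b := by
  ext x
  simp only [orthant, Set.mem_preimage, Set.mem_ofPred_eq, mulVec_diagonal]
  refine forall_congr' fun i => ?_
  cases b i
  · simp [mul_pos_iff_of_pos_left (hd i)]
  · simp [mul_neg_iff, hd i, (hd i).not_gt]

theorem posDef_sigmaQ {n nz : ℕ} (A : Matrix (Fin n) (Fin nz) ℝ)
    {Sz : Matrix (Fin nz) (Fin nz) ℝ} (hSz : Sz.PosSemidef) : (sigmaQ A Sz).PosDef := by
  refine PosDef.one.add_posSemidef (PosSemidef.smul ?_ (by positivity))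
  simpa using hSz.mul_mul_conjTranspose_same A

/-- Matrices with positive diagonal and the same correlations differ by a diagonal rescaling. -/
theorem eq_diagonal_mul_mul_diagonal_of_corrMat_eq {n : ℕ} {S T : Matrix (Fin n) (Fin n) ℝ}
    (hS : ∀ i, 0 < S i i) (hT : ∀ i, 0 < T i i) (h : corrMat S = corrMat T) :
    T = diagonal (fun i => √(T i i) / √(S i i)) * S *
      diagonal (fun i => √(T i i) / √(S i i)) := by
  ext i j
  have hij := congrFun (congrFun h i) j
  simp only [corrMat, of_apply, Real.sqrt_mul (hS i).le, Real.sqrt_mul (hT i).le] at hij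
  have := Real.sqrt_pos.2 (hS i)
  have := Real.sqrt_pos.2 (hS j)
  have := Real.sqrt_pos.2 (hT i)
  have := Real.sqrt_pos.2 (hT j)
  rw [mul_diagonal, diagonal_mul]
  rw [div_eq_div_iff (by positivity) (by positivity)] at hij
  field_simp
  linarith

theorem muQ_surjective {n : ℕ} {A : Matrix (Fin n) (Fin n) ℝ} (hA : IsUnit A.det) :
    Function.Surjective (muQ A) := by
  intro ν
  have hc : -√(π / 8) ≠ 0 := neg_ne_zero.2 (Real.sqrt_pos.2 (by positivity)).ne'
  refine ⟨A⁻¹ *ᵥ ((-√(π / 8))⁻¹ • ν), ?_⟩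
  rw [muQ, mulVec_mulVec, mul_nonsing_inv _ hA, one_mulVec, smul_inv_smul₀ hc]

/-- **Theorem 3.** If two binary ICA models with `n = n_z` and invertible mixing
matrices imply the same correlation matrices for `q^u` in every segment, then the
source means of the second model can be adjusted so that the implied binary
distributions are identical to those of the first model in every segment. -/
theorem means_adjustable_given_equal_correlations {U : Type*} {n : ℕ}
    (A A' : Matrix (Fin n) (Fin n) ℝ) (hA : IsUnit A.det) (hA' : IsUnit A'.det)
    (μz μz' : U → Fin n → ℝ) (Sz Sz' : U → Matrix (Fin n) (Fin n) ℝ)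
    (hd : ∀ u, (Sz u).IsDiag) (hp : ∀ u, (Sz u).PosDef)
    (hd' : ∀ u, (Sz' u).IsDiag) (hp' : ∀ u, (Sz' u).PosDef)
    (hcorr : ∀ u, corrMat (sigmaQ A (Sz u)) = corrMat (sigmaQ A' (Sz' u))) :
    ∃ μt : U → Fin n → ℝ, ∀ (u : U) (b : Fin n → Bool),
      binProb A' (μt u) (Sz' u) b = binProb A (μz u) (Sz u) b := by
  choose f hf using muQ_surjective hA'
  let d (u : U) (i : Fin n) : ℝ := √(sigmaQ A' (Sz' u) i i) / √(sigmaQ A (Sz u) i i)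
  refine ⟨fun u => f (diagonal (d u) *ᵥ muQ A (μz u)), fun u b => ?_⟩
  have hS i : 0 < sigmaQ A (Sz u) i i := (posDef_sigmaQ A (hp u).posSemidef).diag_pos
  have hT i : 0 < sigmaQ A' (Sz' u) i i := (posDef_sigmaQ A' (hp' u).posSemidef).diag_pos
  have hpos i : 0 < d u i := div_pos (Real.sqrt_pos.2 (hT i)) (Real.sqrt_pos.2 (hS i))
  rw [binProb, binProb, hf, eq_diagonal_mul_mul_diagonal_of_corrMat_eq hS hT (hcorr u),
    mvGaussian_diagonal_apply (d u) hpos _ _ (measurableSet_orthant b),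
    preimage_diagonal_orthant (d u) hpos]
end

section
/- Let M = (A, {μ_z^u}_u, {Σ_z^u}_u) and M̂ = (Â, {μ̂_z^u}_u, {Σ̂_z^u}_u) be two binary ICA models with the same dimensions, and suppose there exist diagonal matrices Q^u with strictly positive diagonal entries such that for every segment u: √(π/8) Â μ̂_z^u = Q^u √(π/8) A μ_z^u and I + (π/8) Â Σ̂_z^u Âᵀ = Q^u (I + (π/8) A Σ_z^u Aᵀ) Q^u. Then M and M̂ induce exactly the same probability distribution on the binary observation vector x^u ∈ {0,1}^n in every segment u. -/
open MeasureTheory Matrix Real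

/-- Gaussian measures are equivariant under invertible linear maps. -/
theorem mvGaussian_mulVec_image {n : ℕ} (μ : Fin n → ℝ) (S P : Matrix (Fin n) (Fin n) ℝ)
    (hP : P.det ≠ 0) {s : Set (Fin n → ℝ)} (hs : MeasurableSet s) :
    mvGaussian (P *ᵥ μ) (P * S * Pᵀ) ((P *ᵥ ·) '' s) = mvGaussian μ S s := by
  have hPu : IsUnit P.det := hP.isUnit
  have hPtu : IsUnit Pᵀ.det := by rwa [det_transpose]
  have hinj : Function.Injective (P *ᵥ ·) :=
    mulVec_injective_of_isUnit ((isUnit_iff_isUnit_det P).2 hPu)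
  unfold mvGaussian
  rw [withDensity_apply', withDensity_apply',
    lintegral_image_eq_lintegral_abs_det_fderiv_mul volume hs
      (f := (P *ᵥ ·)) (f' := fun _ => LinearMap.toContinuousLinearMap (toLin' P))
      (fun x _ => (LinearMap.toContinuousLinearMap (toLin' P)).hasFDerivWithinAt)
      hinj.injOn]
  refine lintegral_congr fun x => ?_
  have hdet : (LinearMap.toContinuousLinearMap (toLin' P)).det = P.det := by
    simp [ContinuousLinearMap.det]
  have hquad : (P *ᵥ x - P *ᵥ μ) ⬝ᵥ ((P * S * Pᵀ)⁻¹ *ᵥ (P *ᵥ x - P *ᵥ μ))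
      = (x - μ) ⬝ᵥ (S⁻¹ *ᵥ (x - μ)) := by
    rw [← mulVec_sub, Matrix.mul_inv_rev, Matrix.mul_inv_rev, mulVec_mulVec, Matrix.mul_assoc,
      Matrix.mul_assoc, nonsing_inv_mul P hPu, Matrix.mul_one, ← vecMul_transpose,
      ← dotProduct_mulVec, mulVec_mulVec, mul_nonsing_inv_cancel_left _ _ hPtu]
  have hnorm : |P.det| * √(((2 * π) ^ n * (P * S * Pᵀ).det)⁻¹)
      = √(((2 * π) ^ n * S.det)⁻¹) := by
    rw [← Real.sqrt_sq_eq_abs, ← Real.sqrt_mul (sq_nonneg _), det_mul, det_mul, det_transpose]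
    congr 1
    rw [show (2 * π) ^ n * (P.det * S.det * P.det) = P.det ^ 2 * ((2 * π) ^ n * S.det) by ring,
      mul_inv, mul_inv_cancel_left₀ (pow_ne_zero 2 hP)]
  rw [hdet, ← ENNReal.ofReal_mul (abs_nonneg _), hquad, ← mul_assoc, hnorm]

/-- Positive rescaling of the coordinates preserves every orthant. -/
theorem diagonal_mulVec_image_orthant {n : ℕ} {d : Fin n → ℝ} (hd : ∀ i, 0 < d i)
    (b : Fin n → Bool) : (diagonal d *ᵥ ·) '' orthant b = orthant b := by
  have key : ∀ w, diagonal d *ᵥ w ∈ orthant b ↔ w ∈ orthant b := fun w =>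
    forall_congr' fun i => by
      cases b i <;>
        simp [mulVec_diagonal, mul_pos_iff_of_pos_left (hd i), mul_neg_iff, hd i, (hd i).le]
  refine Set.Subset.antisymm (Set.image_subset_iff.2 fun w hw => (key w).2 hw) fun w hw => ?_
  have hw' : diagonal d *ᵥ (fun i => (d i)⁻¹ * w i) = w := by
    ext i
    rw [mulVec_diagonal, mul_inv_cancel_left₀ (hd i).ne']
  exact ⟨_, (key _).1 (hw'.symm ▸ hw), hw'⟩

/-- **Sufficiency of the binarization indeterminacy equations.** If two binary ICA models
are related by positive diagonal matrices `Q^u` as in Equations (10)–(11), namely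
`√(π/8) Â μ̂_z^u = Q^u √(π/8) A μ_z^u` and
`I + (π/8) Â Σ̂_z^u Âᵀ = Q^u (I + (π/8) A Σ_z^u Aᵀ) Q^u`,
then they induce exactly the same binary distribution in every segment. -/
theorem scaling_relation_implies_same_binary_distribution {U : Type*} {n nz : ℕ}
    (A A' : Matrix (Fin n) (Fin nz) ℝ)
    (hA : LinearIndependent ℝ fun j i => A i j)
    (hA' : LinearIndependent ℝ fun j i => A' i j)
    (μz μz' : U → Fin nz → ℝ) (Sz Sz' : U → Matrix (Fin nz) (Fin nz) ℝ)
    (hd : ∀ u, (Sz u).IsDiag) (hp : ∀ u, (Sz u).PosDef)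
    (hd' : ∀ u, (Sz' u).IsDiag) (hp' : ∀ u, (Sz' u).PosDef)
    (d : U → Fin n → ℝ) (hdpos : ∀ u i, 0 < d u i)
    (hmean : ∀ u, Real.sqrt (Real.pi / 8) • (A' *ᵥ μz' u)
        = Matrix.diagonal (d u) *ᵥ (Real.sqrt (Real.pi / 8) • (A *ᵥ μz u)))
    (hcov : ∀ u, (1 : Matrix (Fin n) (Fin n) ℝ) + (Real.pi / 8) • (A' * Sz' u * A'ᵀ)
        = Matrix.diagonal (d u) *
            ((1 : Matrix (Fin n) (Fin n) ℝ) + (Real.pi / 8) • (A * Sz u * Aᵀ)) *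
            Matrix.diagonal (d u)) :
    ∀ (u : U) (b : Fin n → Bool),
      binProb A' (μz' u) (Sz' u) b = binProb A (μz u) (Sz u) b := by
  intro u b
  have hmu : muQ A' (μz' u) = diagonal (d u) *ᵥ muQ A (μz u) := by
    rw [muQ, muQ, neg_smul, neg_smul, mulVec_neg, hmean u]
  have hsigma : sigmaQ A' (Sz' u) = diagonal (d u) * sigmaQ A (Sz u) * (diagonal (d u))ᵀ := by
    rw [diagonal_transpose]
    exact hcov u
  have hdet : (diagonal (d u)).det ≠ 0 := by
    rw [det_diagonal]
    exact Finset.prod_ne_zero_iff.2 fun i _ => (hdpos u i).ne'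
  rw [binProb, binProb, hmu, hsigma,
    ← mvGaussian_mulVec_image (muQ A (μz u)) (sigmaQ A (Sz u)) _ hdet (measurableSet_orthant b),
    diagonal_mulVec_image_orthant (hdpos u)]
end

section
/- Let μ ∈ ℝ, σ > 0 and c ∈ ℝ. Then ∫_ℝ Φ(c y) dN(μ, σ²)(y) = Φ(cμ / √(1 + c²σ²)), where Φ is the standard normal CDF and N(μ, σ²) is the Gaussian measure with mean μ and variance σ². Equivalently, for y ~ N(μ, σ²) and an independent standard normal n, this is the probability P(n < c y). -/
open MeasureTheory Matrix Real

/-- The standard normal CDF at `t` is the mass which `N(0, 1)` gives to `(-∞, t)`. -/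
theorem gaussianReal_Iio_eq_stdNormalCDF (t : ℝ) :
    ProbabilityTheory.gaussianReal 0 1 (Set.Iio t) = ENNReal.ofReal (stdNormalCDF t) := by
  have := ProbabilityTheory.nullSingletonClass_gaussianReal (μ := 0) (v := 1) one_ne_zero
  rw [measure_congr Iio_ae_eq_Iic,
    ProbabilityTheory.gaussianReal_apply_eq_integral 0 one_ne_zero, stdNormalCDF]
  simp [ProbabilityTheory.gaussianPDFReal]

theorem stdNormalCDF_nonneg (t : ℝ) : 0 ≤ stdNormalCDF t :=
  integral_nonneg fun _ => by positivity

theorem monotone_stdNormalCDF : Monotone stdNormalCDF := fun s t hst => by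
  rw [← ENNReal.ofReal_le_ofReal_iff (stdNormalCDF_nonneg t),
    ← gaussianReal_Iio_eq_stdNormalCDF, ← gaussianReal_Iio_eq_stdNormalCDF]
  exact measure_mono (Set.Iio_subset_Iio hst)

theorem gaussianReal_Iio_eq_stdNormalCDF_div (m : ℝ) {v : NNReal} (hv : v ≠ 0) (t : ℝ) :
    ProbabilityTheory.gaussianReal m v (Set.Iio t) =
      ENNReal.ofReal (stdNormalCDF ((t - m) / Real.sqrt v)) := by
  have hs : 0 < Real.sqrt v := Real.sqrt_pos.2 (by positivity)
  have hmap : ((ProbabilityTheory.gaussianReal 0 1).map (Real.sqrt v * ·)).map (m + ·) =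
      ProbabilityTheory.gaussianReal m v := by
    rw [ProbabilityTheory.gaussianReal_map_const_mul,
      ProbabilityTheory.gaussianReal_map_const_add]
    congr 1
    · simp
    · ext
      simp
  rw [← hmap, Measure.map_apply (by fun_prop) measurableSet_Iio,
    Measure.map_apply (by fun_prop) (measurableSet_Iio.preimage (by fun_prop)),
    ← gaussianReal_Iio_eq_stdNormalCDF]
  congr 1
  ext x
  simp only [Set.mem_preimage, Set.mem_Iio]
  rw [lt_div_iff₀ hs]
  constructor <;> intro h <;> linarith

/-- `P(n < c y)` for independent `n ~ N(0, 1)` and `y ~ N(m, v)`. -/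
theorem gaussianReal_prod_lt_mul (m c : ℝ) (v : NNReal) :
    ((ProbabilityTheory.gaussianReal 0 1).prod (ProbabilityTheory.gaussianReal m v))
        {p : ℝ × ℝ | p.1 < c * p.2} =
      ENNReal.ofReal (stdNormalCDF (c * m / Real.sqrt (1 + c ^ 2 * v))) := by
  have hmap : ((ProbabilityTheory.gaussianReal 0 1).prod
      (ProbabilityTheory.gaussianReal m v)).map (fun p => p.1 + -c * p.2) =
        ProbabilityTheory.gaussianReal (0 + -c * m) (1 + NNReal.mk ((-c) ^ 2) (sq_nonneg _) * v) := by
    rw [← ProbabilityTheory.gaussianReal_conv_gaussianReal,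
      ← ProbabilityTheory.gaussianReal_map_const_mul, Measure.conv]
    conv_rhs => rw [← Measure.map_id (μ := ProbabilityTheory.gaussianReal 0 1)]
    rw [Measure.map_prod_map _ _ (by fun_prop) (by fun_prop),
      Measure.map_map (by fun_prop) (by fun_prop)]
    rfl
  have hset : {p : ℝ × ℝ | p.1 < c * p.2} = (fun p : ℝ × ℝ => p.1 + -c * p.2) ⁻¹' Set.Iio 0 := by
    ext p
    simp only [Set.mem_ofPred_eq, Set.mem_preimage, Set.mem_Iio]
    constructor <;> intro h <;> linarith
  rw [hset, ← Measure.map_apply (by fun_prop) measurableSet_Iio, hmap,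
    gaussianReal_Iio_eq_stdNormalCDF_div _ (by positivity)]
  simp

theorem lintegral_stdNormalCDF_mul (ν : Measure ℝ) [SFinite ν] (c : ℝ) :
    ∫⁻ y, ENNReal.ofReal (stdNormalCDF (c * y)) ∂ν =
      ((ProbabilityTheory.gaussianReal 0 1).prod ν) {p : ℝ × ℝ | p.1 < c * p.2} := by
  rw [Measure.prod_apply_symm (measurableSet_lt (by fun_prop) (by fun_prop))]
  exact lintegral_congr fun y => (gaussianReal_Iio_eq_stdNormalCDF (c * y)).symm

/-- **Gaussian integral of the Gaussian CDF.** For `y ~ N(μ, σ²)` and `c ∈ ℝ`,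
`∫ Φ(c y) dN(μ, σ²)(y) = Φ(cμ / √(1 + c²σ²))`; equivalently, this is the probability
that an independent standard normal `n` satisfies `n < c y`. -/
theorem integral_stdNormalCDF_gaussian (μ σ c : ℝ) (hσ : 0 < σ) :
    (∫ y, stdNormalCDF (c * y)
        ∂(ProbabilityTheory.gaussianReal μ (Real.toNNReal (σ ^ 2))))
      = stdNormalCDF (c * μ / Real.sqrt (1 + c ^ 2 * σ ^ 2)) ∧
    ((ProbabilityTheory.gaussianReal 0 1).prod
        (ProbabilityTheory.gaussianReal μ (Real.toNNReal (σ ^ 2))))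
        {p : ℝ × ℝ | p.1 < c * p.2}
      = ENNReal.ofReal (stdNormalCDF (c * μ / Real.sqrt (1 + c ^ 2 * σ ^ 2))) := by
  have hprod := gaussianReal_prod_lt_mul μ c (Real.toNNReal (σ ^ 2))
  rw [Real.coe_toNNReal _ (sq_nonneg σ)] at hprod
  refine ⟨?_, hprod⟩
  rw [integral_eq_lintegral_of_nonneg_ae (.of_forall fun y => stdNormalCDF_nonneg _)
    (monotone_stdNormalCDF.measurable.comp (measurable_const_mul c)).aestronglyMeasurable,
    lintegral_stdNormalCDF_mul, hprod, ENNReal.toReal_ofReal (stdNormalCDF_nonneg _)]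
end

section
/- Let A be a real n×n_z matrix, μ_z ∈ ℝ^{n_z}, and Σ_z a diagonal positive-definite n_z×n_z matrix. Then ∫_{ℝ^n} ∏_{i=1}^n Φ(√(π/8) y_i) dN(Aμ_z, AΣ_zAᵀ)(y) equals the probability, under the Gaussian measure N(μ_q, Σ_q) with μ_q = −√(π/8) A μ_z and Σ_q = I_n + (π/8) A Σ_z Aᵀ, of the negative orthant {w ∈ ℝ^n : w_i < 0 for all i}. In the binary ICA model this is the probability that the binary observation vector is the all-ones vector. -/
open MeasureTheory Matrix Real

open ProbabilityTheory

/-- The standard Gaussian measure on `ι → ℝ`, with independent standard normal coordinates. -/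
noncomputable def stdGaussianPi (ι : Type*) [Fintype ι] : Measure (ι → ℝ) :=
  Measure.pi fun _ => gaussianReal 0 1

instance {ι : Type*} [Fintype ι] : IsProbabilityMeasure (stdGaussianPi ι) := by
  unfold stdGaussianPi; infer_instance

lemma stdGaussianPi_eq_withDensity (ι : Type*) [Fintype ι] :
    stdGaussianPi ι =
      volume.withDensity fun x => ENNReal.ofReal (∏ i, gaussianPDFReal 0 1 (x i)) := by
  refine Measure.pi_eq fun s hs => ?_
  rw [withDensity_apply _ (MeasurableSet.univ_pi hs), volume_pi, Measure.restrict_pi_pi,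
    ← ofReal_integral_eq_lintegral_ofReal, integral_fintype_prod_eq_prod,
    ENNReal.ofReal_prod_of_nonneg]
  · exact Finset.prod_congr rfl fun i _ =>
      (gaussianReal_apply_eq_integral 0 one_ne_zero (s i)).symm
  · exact fun i _ => integral_nonneg fun x => gaussianPDFReal_nonneg 0 1 x
  · exact Integrable.fintype_prod_dep fun i => (integrable_gaussianPDFReal 0 1).restrict
  · exact Filter.Eventually.of_forall fun x =>
      Finset.prod_nonneg fun i _ => gaussianPDFReal_nonneg 0 1 (x i)

lemma prod_gaussianPDFReal_zero_one {n : ℕ} (x : Fin n → ℝ) :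
    ∏ i, gaussianPDFReal 0 1 (x i) =
      Real.sqrt ((2 * Real.pi) ^ n)⁻¹ * Real.exp (-(1 / 2) * (x ⬝ᵥ x)) := by
  have h : Real.sqrt ((2 * Real.pi) ^ n)⁻¹ = (Real.sqrt (2 * Real.pi))⁻¹ ^ n := by
    rw [← inv_pow, ← Real.sqrt_inv, Real.sqrt_eq_iff_mul_self_eq (by positivity) (by positivity),
      ← mul_pow, Real.mul_self_sqrt (by positivity)]
  simp only [gaussianPDFReal, Finset.prod_mul_distrib, ← Real.exp_sum, dotProduct,
    Finset.mul_sum, h]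
  simp only [NNReal.coe_one, mul_one, Finset.prod_const, Finset.card_univ, Fintype.card_fin,
    sub_zero]
  congr 2
  exact Finset.sum_congr rfl fun i _ => by ring

lemma mvGaussian_mul_transpose {n : ℕ} (m : Fin n → ℝ) (B : Matrix (Fin n) (Fin n) ℝ)
    (hB : B.det ≠ 0) :
    mvGaussian m (B * Bᵀ) = (stdGaussianPi (Fin n)).map fun x => m + B *ᵥ x := by
  have hmeas : Measurable fun x : Fin n → ℝ => m + B *ᵥ x := by fun_prop
  have hvol : (volume : Measure (Fin n → ℝ)) =
      ENNReal.ofReal |B.det| • volume.map fun x : Fin n → ℝ => m + B *ᵥ x := by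
    have h1 : (volume : Measure (Fin n → ℝ)).map (fun x => m + B *ᵥ x) =
        ENNReal.ofReal |B.det⁻¹| • volume := by
      have h2 := Real.map_matrix_volume_pi_eq_smul_volume_pi hB
      have h3 : (fun x : Fin n → ℝ => m + B *ᵥ x) = (fun y => m + y) ∘ toLin' B := by
        ext x; simp
      rw [h3, ← Measure.map_map (by fun_prop)
        (LinearMap.continuous_of_finiteDimensional _).measurable, h2, Measure.map_smul,
        map_add_left_eq_self]
    rw [h1, smul_smul, ← ENNReal.ofReal_mul (abs_nonneg _), ← abs_mul, mul_inv_cancel₀ hB]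
    simp
  have hdens : ∀ x : Fin n → ℝ,
      |B.det| * (Real.sqrt (((2 * Real.pi) ^ n * (B * Bᵀ).det)⁻¹) *
        Real.exp (-(1 / 2) * ((m + B *ᵥ x - m) ⬝ᵥ ((B * Bᵀ)⁻¹ *ᵥ (m + B *ᵥ x - m))))) =
      ∏ i, gaussianPDFReal 0 1 (x i) := by
    intro x
    have hU : IsUnit B.det := isUnit_iff_ne_zero.2 hB
    have hUt : IsUnit Bᵀ.det := by rwa [det_transpose]
    have hq : (B *ᵥ x) ⬝ᵥ ((B * Bᵀ)⁻¹ *ᵥ (B *ᵥ x)) = x ⬝ᵥ x := by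
      rw [Matrix.mul_inv_rev, mulVec_mulVec, Matrix.mul_assoc, nonsing_inv_mul _ hU, Matrix.mul_one,
        ← vecMul_transpose, ← dotProduct_mulVec, mulVec_mulVec, mul_nonsing_inv _ hUt, one_mulVec]
    have hs : Real.sqrt (((2 * Real.pi) ^ n * (B * Bᵀ).det)⁻¹) =
        Real.sqrt ((2 * Real.pi) ^ n)⁻¹ * |B.det|⁻¹ := by
      rw [det_mul, det_transpose, mul_inv, Real.sqrt_mul (by positivity), Real.sqrt_inv (_ * _),
        Real.sqrt_mul_self_eq_abs]
    rw [add_sub_cancel_left, hq, hs, prod_gaussianPDFReal_zero_one]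
    have : |B.det| ≠ 0 := abs_ne_zero.2 hB
    field_simp
  rw [stdGaussianPi_eq_withDensity, mvGaussian]
  ext s hs
  rw [Measure.map_apply hmeas hs, withDensity_apply _ hs, withDensity_apply _ (hmeas hs)]
  conv_lhs => rw [hvol]
  rw [Measure.restrict_smul, lintegral_smul_measure, setLIntegral_map hs (by fun_prop) hmeas,
    smul_eq_mul, ← lintegral_const_mul _ (by fun_prop)]
  refine lintegral_congr fun x => ?_
  rw [← ENNReal.ofReal_mul (abs_nonneg _), hdens]

lemma charFunDual_map_mulVec_stdGaussianPi {ι κ : Type*} [Fintype ι] [Fintype κ] [DecidableEq κ]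
    (C : Matrix κ ι ℝ) (L : StrongDual ℝ (κ → ℝ)) :
    charFunDual ((stdGaussianPi ι).map fun x => C *ᵥ x) L =
      Complex.exp (-((((fun k => L (Pi.single k 1)) ⬝ᵥ
        ((C * Cᵀ) *ᵥ fun k => L (Pi.single k 1)) : ℝ) : ℂ) / 2)) := by
  set v : κ → ℝ := fun k => L (Pi.single k 1) with hv
  have hL : ∀ x, L (C *ᵥ x) = (v ᵥ* C) ⬝ᵥ x := by
    intro x
    rw [← dotProduct_mulVec]
    conv_lhs => rw [← Finset.univ_sum_single (C *ᵥ x)]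
    rw [map_sum, dotProduct]
    refine Finset.sum_congr rfl fun k _ => ?_
    have hk : (Pi.single k ((C *ᵥ x) k) : κ → ℝ) = (C *ᵥ x) k • Pi.single k 1 := by
      rw [← Pi.single_smul', smul_eq_mul, mul_one]
    rw [hk, map_smul, smul_eq_mul, mul_comm]
  have hq : v ⬝ᵥ ((C * Cᵀ) *ᵥ v) = ∑ i, (v ᵥ* C) i ^ 2 := by
    rw [← mulVec_mulVec, dotProduct_mulVec, mulVec_transpose, dotProduct]
    simp only [sq]
  rw [charFunDual_apply, integral_map (by fun_prop) (by fun_prop)]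
  have : ∀ x : ι → ℝ, Complex.exp (L (C *ᵥ x) * Complex.I) =
      ∏ i, Complex.exp (((v ᵥ* C) i : ℂ) * (x i) * Complex.I) := by
    intro x
    rw [hL, ← Complex.exp_sum, dotProduct, ← Finset.sum_mul]
    push_cast
    rfl
  simp_rw [this]
  rw [stdGaussianPi, integral_fintype_prod_eq_prod
    (f := fun i (y : ℝ) => Complex.exp (((v ᵥ* C) i : ℂ) * y * Complex.I))]
  simp_rw [← charFun_apply_real, charFun_gaussianReal]
  rw [hq, ← Complex.exp_sum]
  congr 1
  push_cast
  simp [Finset.sum_div]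

lemma map_mulVec_stdGaussianPi_congr {ι ι' κ : Type*} [Fintype ι] [Fintype ι'] [Fintype κ]
    {C : Matrix κ ι ℝ} {D : Matrix κ ι' ℝ} (h : C * Cᵀ = D * Dᵀ) :
    ((stdGaussianPi ι).map fun x => C *ᵥ x) = (stdGaussianPi ι').map fun x => D *ᵥ x := by
  classical
  have h1 : IsProbabilityMeasure ((stdGaussianPi ι).map fun x => C *ᵥ x) :=
    Measure.isProbabilityMeasure_map (by fun_prop)
  have h2 : IsProbabilityMeasure ((stdGaussianPi ι').map fun x => D *ᵥ x) :=
    Measure.isProbabilityMeasure_map (by fun_prop)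
  refine Measure.ext_of_charFunDual (funext fun L => ?_)
  rw [charFunDual_map_mulVec_stdGaussianPi, charFunDual_map_mulVec_stdGaussianPi, h]

open scoped MatrixOrder in
lemma Matrix.PosDef.exists_mul_transpose {n : ℕ} {S : Matrix (Fin n) (Fin n) ℝ} (hS : S.PosDef) :
    ∃ B : Matrix (Fin n) (Fin n) ℝ, B.det ≠ 0 ∧ B * Bᵀ = S := by
  obtain ⟨B, rfl⟩ := CStarAlgebra.nonneg_iff_eq_star_mul_self.mp hS.posSemidef.nonneg
  have hd := hS.det_pos
  rw [det_mul] at hd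
  refine ⟨Bᵀ, ?_, ?_⟩
  · rw [det_transpose]
    exact right_ne_zero_of_mul hd.ne'
  · simp [star_eq_conjTranspose]

/-- A Gaussian with covariance `C * Cᵀ` is the affine image of a standard Gaussian, even when
`C` is not square. -/
lemma mvGaussian_eq_map_of_mul_transpose {n : ℕ} {ι : Type*} [Fintype ι] (m : Fin n → ℝ)
    {S : Matrix (Fin n) (Fin n) ℝ} (hS : S.PosDef) (C : Matrix (Fin n) ι ℝ) (hC : C * Cᵀ = S) :
    mvGaussian m S = (stdGaussianPi ι).map fun x => m + C *ᵥ x := by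
  obtain ⟨B, hB, hBS⟩ := hS.exists_mul_transpose
  have h := congrArg (Measure.map fun y => m + y)
    (map_mulVec_stdGaussianPi_congr (hBS.trans hC.symm))
  rw [Measure.map_map (by fun_prop) (by fun_prop),
    Measure.map_map (by fun_prop) (by fun_prop)] at h
  rw [← hBS, mvGaussian_mul_transpose m B hB]
  exact h

lemma stdNormalCDF_eq_measureReal_Iio (t : ℝ) :
    stdNormalCDF t = (gaussianReal 0 1).real (Set.Iio t) := by
  have := nullSingletonClass_gaussianReal (μ := 0) (v := 1) one_ne_zero
  rw [measureReal_congr Iio_ae_eq_Iic, measureReal_def,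
    gaussianReal_apply_eq_integral _ one_ne_zero, ENNReal.toReal_ofReal
      (integral_nonneg fun x => gaussianPDFReal_nonneg 0 1 x)]
  simp [stdNormalCDF, gaussianPDFReal]

lemma prod_stdNormalCDF {ι : Type*} [Fintype ι] (t : ι → ℝ) :
    ∏ i, stdNormalCDF (t i) = (stdGaussianPi ι).real {e | ∀ i, e i < t i} := by
  have h : {e : ι → ℝ | ∀ i, e i < t i} = Set.univ.pi fun i => Set.Iio (t i) := by
    ext e; simp
  simp only [h, measureReal_def, stdGaussianPi, Measure.pi_pi, ENNReal.toReal_prod,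
    stdNormalCDF_eq_measureReal_Iio]

lemma measurable_stdNormalCDF : Measurable stdNormalCDF := by
  refine Monotone.measurable fun s t hst => ?_
  simp only [stdNormalCDF_eq_measureReal_Iio]
  exact measureReal_mono (Set.Iio_subset_Iio hst)

lemma stdGaussianPi_sum_apply {ι κ : Type*} [Fintype ι] [Fintype κ] {s : Set (ι ⊕ κ → ℝ)}
    (hs : MeasurableSet s) :
    (stdGaussianPi (ι ⊕ κ)).real s =
      ∫ x, (stdGaussianPi κ).real {e | Sum.elim x e ∈ s} ∂stdGaussianPi ι := by
  have hmp := (measurePreserving_sumPiEquivProdPi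
    (fun _ : ι ⊕ κ => gaussianReal 0 1)).symm
  have h : (stdGaussianPi (ι ⊕ κ)).real s = ((stdGaussianPi ι).prod (stdGaussianPi κ)).real
      ((MeasurableEquiv.sumPiEquivProdPi fun _ : ι ⊕ κ => ℝ).symm ⁻¹' s) :=
    (hmp.measureReal_preimage hs.nullMeasurableSet).symm
  have hs' := (MeasurableEquiv.sumPiEquivProdPi fun _ : ι ⊕ κ => ℝ).symm.measurable hs
  rw [h, measureReal_def, Measure.prod_apply hs', ← integral_toReal
    (measurable_measure_prodMk_left hs').aemeasurable
    (Filter.Eventually.of_forall fun _ => measure_lt_top _ _)]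
  refine integral_congr_ae (Filter.Eventually.of_forall fun x => ?_)
  have he : ∀ e : κ → ℝ, (MeasurableEquiv.sumPiEquivProdPi fun _ : ι ⊕ κ => ℝ).symm (x, e) =
      Sum.elim x e := by
    intro e; ext (i | i) <;> rfl
  simp only [measureReal_def, Set.preimage, Set.mem_ofPred_eq, he]

/-- **Probability of the all-ones observation.** With `y = A z` for
`z ~ N(μ_z, Σ_z)` (so `y ~ N(A μ_z, A Σ_z Aᵀ)`), the integral
`∫ ∏ i Φ(√(π/8) y_i) dN(A μ_z, A Σ_z Aᵀ)(y)` equals the probability of the negative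
orthant under `N(μ_q, Σ_q)` with `μ_q = −√(π/8) A μ_z`, `Σ_q = I + (π/8) A Σ_z Aᵀ`;
in the binary ICA model this is the probability that the observation is all ones. -/
theorem prob_all_ones {n nz : ℕ} (A : Matrix (Fin n) (Fin nz) ℝ)
    (μz : Fin nz → ℝ) (Sz : Matrix (Fin nz) (Fin nz) ℝ)
    (hd : Sz.IsDiag) (hp : Sz.PosDef) :
    (∫ y, ∏ i, stdNormalCDF (Real.sqrt (Real.pi / 8) * y i)
        ∂(Measure.map (fun z => A *ᵥ z) (mvGaussian μz Sz)))
      = (mvGaussian ((-Real.sqrt (Real.pi / 8)) • (A *ᵥ μz))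
          ((1 : Matrix (Fin n) (Fin n) ℝ) + (Real.pi / 8) • (A * Sz * Aᵀ))
          {w | ∀ i, w i < 0}).toReal := by
  obtain ⟨B, hB, rfl⟩ := hp.exists_mul_transpose
  set c := Real.sqrt (Real.pi / 8) with hc
  have hcc : c * c = Real.pi / 8 := Real.mul_self_sqrt (by positivity)
  have hC : fromCols ((-c) • (A * B)) (1 : Matrix (Fin n) (Fin n) ℝ) *
      (fromCols ((-c) • (A * B)) (1 : Matrix (Fin n) (Fin n) ℝ))ᵀ =
      1 + (Real.pi / 8) • (A * (B * Bᵀ) * Aᵀ) := by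
    rw [transpose_fromCols, fromCols_mul_fromRows, transpose_smul, transpose_one, transpose_mul,
      Matrix.smul_mul, Matrix.mul_smul, smul_smul, neg_mul_neg, hcc, Matrix.mul_one, add_comm]
    simp only [Matrix.mul_assoc]
  have hS : (1 + (Real.pi / 8) • (A * (B * Bᵀ) * Aᵀ)).PosDef := by
    refine PosDef.one.add_posSemidef (PosSemidef.smul ?_ (by positivity))
    simpa using hp.posSemidef.mul_mul_conjTranspose_same A
  have hmeas : MeasurableSet {w : Fin n → ℝ | ∀ i, w i < 0} := by
    simp only [Set.ofPred_forall]
    exact MeasurableSet.iInter fun i => measurableSet_lt (by fun_prop) (by fun_prop)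
  have hΦ : Measurable fun y : Fin n → ℝ => ∏ i, stdNormalCDF (c * y i) :=
    Finset.measurable_prod _ fun i _ => measurable_stdNormalCDF.comp (by fun_prop)
  rw [mvGaussian_eq_map_of_mul_transpose _ hS _ hC, mvGaussian_mul_transpose μz B hB,
    Measure.map_map (by fun_prop) (by fun_prop), integral_map (by fun_prop)
      hΦ.aestronglyMeasurable, Measure.map_apply (by fun_prop) hmeas, ← measureReal_def,
    stdGaussianPi_sum_apply (by exact measurableSet_preimage (by fun_prop) hmeas)]
  refine integral_congr_ae (Filter.Eventually.of_forall fun x => ?_)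
  simp only [prod_stdNormalCDF]
  congr 1
  ext e
  refine forall_congr' fun i => ?_
  simp only [Function.comp_apply, fromCols_mulVec, Sum.elim_comp_inl, Sum.elim_comp_inr, one_mulVec,
    mulVec_add, mulVec_mulVec, smul_mulVec, Pi.add_apply, Pi.smul_apply, smul_eq_mul]
  constructor <;> intro h <;> linarith
end

section
/- Let μ = (μ₁, μ₂) ∈ ℝ² and −1 < β < α < 1, and for ρ ∈ {α, β} let P_ρ denote the bivariate Gaussian measure with mean μ, unit variances, and correlation ρ (covariance [[1, ρ], [ρ, 1]]). Then at least one of the following strict inequalities holds: P_α(q₁ < 0 and q₂ < 0) > P_β(q₁ < 0 and q₂ < 0), or P_α(q₁ > 0 and q₂ > 0) > P_β(q₁ > 0 and q₂ > 0). In particular, the distributions induced on {0,1}² by binarizing at 0 (x_i = 1 iff q_i < 0) under P_α and P_β are different. -/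
open MeasureTheory Matrix Real

open ProbabilityTheory

/-- The density of the bivariate Gaussian measure with mean `(m₁, m₂)`, unit variances and
correlation `ρ`, factored as the first marginal times the conditional density of the second
coordinate. -/
noncomputable def bivariateGaussianPDF (m₁ m₂ ρ : ℝ) (z : ℝ × ℝ) : ENNReal :=
  gaussianPDF m₁ 1 z.1 * gaussianPDF (m₂ + ρ * (z.1 - m₁)) (1 - ρ ^ 2).toNNReal z.2

lemma gaussianPDFReal_mul_gaussianPDFReal (m₁ m₂ x y : ℝ) {ρ : ℝ} (hρ : 0 < 1 - ρ ^ 2) :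
    gaussianPDFReal m₁ 1 x *
        gaussianPDFReal (m₂ + ρ * (x - m₁)) (1 - ρ ^ 2).toNNReal y =
      √(((2 * π) ^ 2 * (1 - ρ ^ 2))⁻¹) * rexp (-(1 / 2) *
        (((x - m₁) ^ 2 - 2 * ρ * (x - m₁) * (y - m₂) + (y - m₂) ^ 2) / (1 - ρ ^ 2))) := by
  simp only [gaussianPDFReal, Real.coe_toNNReal _ hρ.le, NNReal.coe_one]
  rw [mul_mul_mul_comm, ← Real.exp_add, ← mul_inv, ← Real.sqrt_mul (by positivity), ← Real.sqrt_inv]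
  congr 2
  · ring_nf
  · field_simp
    ring

lemma bivariateGaussianPDF_swap (m₁ m₂ x y : ℝ) {ρ : ℝ} (hρ : 0 < 1 - ρ ^ 2) :
    bivariateGaussianPDF m₁ m₂ ρ (x, y) = bivariateGaussianPDF m₂ m₁ ρ (y, x) := by
  simp only [bivariateGaussianPDF, gaussianPDF,
    ← ENNReal.ofReal_mul (gaussianPDFReal_nonneg _ _ _),
    gaussianPDFReal_mul_gaussianPDFReal _ _ _ _ hρ]
  congr 4
  ring

lemma measurable_bivariateGaussianPDF (m₁ m₂ ρ : ℝ) :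
    Measurable (bivariateGaussianPDF m₁ m₂ ρ) := by
  unfold bivariateGaussianPDF gaussianPDF gaussianPDFReal
  fun_prop

lemma mvGaussian_fin_two_apply (m₁ m₂ : ℝ) {ρ : ℝ} (hρ : 0 < 1 - ρ ^ 2) {s t : Set ℝ}
    (hs : MeasurableSet s) (ht : MeasurableSet t) :
    mvGaussian ![m₁, m₂] !![1, ρ; ρ, 1] {w | w 0 ∈ s ∧ w 1 ∈ t} =
      ∫⁻ z in s ×ˢ t, bivariateGaussianPDF m₁ m₂ ρ z := by
  have hpre : {w : Fin 2 → ℝ | w 0 ∈ s ∧ w 1 ∈ t} =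
      MeasurableEquiv.finTwoArrow ⁻¹' (s ×ˢ t) := by
    ext w
    simp [MeasurableEquiv.finTwoArrow]
  rw [mvGaussian, hpre,
    withDensity_apply _ (MeasurableEquiv.finTwoArrow.measurable (hs.prod ht)),
    ← (volume_preserving_finTwoArrow ℝ).setLIntegral_comp_preimage (hs.prod ht)
      (measurable_bivariateGaussianPDF m₁ m₂ ρ)]
  congr 1 with w
  simp only [bivariateGaussianPDF, gaussianPDF,
    ← ENNReal.ofReal_mul (gaussianPDFReal_nonneg _ _ _),
    gaussianPDFReal_mul_gaussianPDFReal _ _ _ _ hρ]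
  have hdet : !![1, ρ; ρ, 1].det = 1 - ρ ^ 2 := by
    rw [Matrix.det_fin_two_of]
    ring
  rw [Matrix.inv_def, hdet, Matrix.adjugate_fin_two_of, Ring.inverse_eq_inv']
  congr 4
  simp [dotProduct, Matrix.mulVec, Fin.sum_univ_two, MeasurableEquiv.finTwoArrow]
  field_simp
  ring

lemma setLIntegral_bivariateGaussianPDF (m₁ m₂ : ℝ) {ρ : ℝ} (hρ : 0 < 1 - ρ ^ 2) (s t : Set ℝ) :
    ∫⁻ z in s ×ˢ t, bivariateGaussianPDF m₁ m₂ ρ z =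
      ∫⁻ x in s, gaussianPDF m₁ 1 x *
        gaussianReal (m₂ + ρ * (x - m₁)) (1 - ρ ^ 2).toNNReal t := by
  rw [Measure.volume_eq_prod,
    setLIntegral_prod _ (measurable_bivariateGaussianPDF _ _ _).aemeasurable]
  congr 1 with x
  rw [gaussianReal_apply _ (by simpa using hρ), ← lintegral_const_mul _ (measurable_gaussianPDF _ _)]
  rfl

/-- The second marginal of a bivariate Gaussian does not depend on the correlation. -/
lemma lintegral_gaussianPDF_mul_gaussianReal (m₁ m₂ : ℝ) {ρ : ℝ} (hρ : 0 < 1 - ρ ^ 2) (t : Set ℝ) :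
    ∫⁻ x, gaussianPDF m₁ 1 x * gaussianReal (m₂ + ρ * (x - m₁)) (1 - ρ ^ 2).toNNReal t =
      gaussianReal m₂ 1 t := by
  rw [← setLIntegral_univ, ← setLIntegral_bivariateGaussianPDF _ _ hρ, Measure.volume_eq_prod,
    setLIntegral_prod_symm _ (measurable_bivariateGaussianPDF _ _ _).aemeasurable,
    gaussianReal_apply _ one_ne_zero]
  congr 1 with y
  simp_rw [bivariateGaussianPDF_swap m₁ m₂ _ y hρ, bivariateGaussianPDF]
  rw [lintegral_const_mul _ (measurable_gaussianPDF _ _), setLIntegral_univ,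
    lintegral_gaussianPDF_eq_one _ (by simpa using hρ), mul_one]

lemma gaussianReal_Iio_eq_standard (m : ℝ) {v : ℝ} (hv : 0 < v) (c : ℝ) :
    gaussianReal m v.toNNReal (Set.Iio c) = gaussianReal 0 1 (Set.Iio ((c - m) / √v)) := by
  have hsqrt : 0 < √v := Real.sqrt_pos.2 hv
  have hmap : ((gaussianReal 0 1).map (√v * ·)).map (· + m) = gaussianReal m v.toNNReal := by
    rw [gaussianReal_map_const_mul, gaussianReal_map_add_const]
    congr 1
    · ring
    · ext
      simp [Real.sq_sqrt hv.le, hv.le]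
  rw [← hmap, Measure.map_apply (by fun_prop) measurableSet_Iio,
    Measure.map_apply (by fun_prop) (by measurability)]
  congr 1
  ext x
  simp only [Set.mem_preimage, Set.mem_Iio]
  rw [lt_div_iff₀ hsqrt, lt_sub_iff_add_lt, mul_comm x]

lemma strictMono_gaussianReal_Iio : StrictMono fun z ↦ gaussianReal 0 1 (Set.Iio z) := by
  intro a b hab
  have := (gaussianReal_absolutelyContinuous' 0 one_ne_zero).isOpenPosMeasure
  have hpos : 0 < gaussianReal 0 1 (Set.Ico a b) :=
    ((Measure.measure_Ioo_pos _).2 hab).trans_le (measure_mono Set.Ioo_subset_Ico_self)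
  simp only
  rw [← Set.Iio_union_Ico_eq_Iio hab.le,
    measure_union (Set.disjoint_left.2 fun x hx hx' ↦ hx.not_ge hx'.1) measurableSet_Ico]
  exact ENNReal.lt_add_right (measure_ne_top _ _) hpos.ne'

lemma div_sqrt_one_sub_sq_lt {α β : ℝ} (hβ : -1 < β) (hαβ : β < α) (hα : α < 1) :
    β / √(1 - β ^ 2) < α / √(1 - α ^ 2) := by
  have hvα : 0 < 1 - α ^ 2 := by nlinarith
  have hvβ : 0 < 1 - β ^ 2 := by nlinarith
  have ha := Real.sqrt_pos.2 hvα
  have hb := Real.sqrt_pos.2 hvβ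
  have hsa := Real.sq_sqrt hvα.le
  have hsb := Real.sq_sqrt hvβ.le
  rw [div_lt_div_iff₀ hb ha]
  set a := √(1 - α ^ 2)
  set b := √(1 - β ^ 2)
  have key : (α * b) ^ 2 - (β * a) ^ 2 = α ^ 2 - β ^ 2 := by
    rw [mul_pow, mul_pow, hsa, hsb]
    ring
  rcases le_or_gt 0 β with h | h
  · nlinarith [mul_pos (h.trans_lt hαβ) hb, mul_nonneg h ha.le]
  · rcases le_or_gt 0 α with hα₀ | hα₀
    · exact (mul_neg_of_neg_of_pos h ha).trans_le (mul_nonneg hα₀ hb.le)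
    · nlinarith [mul_neg_of_neg_of_pos h ha, mul_neg_of_neg_of_pos hα₀ hb]

/-- Bivariate case of Slepian's inequality, in its strict form. -/
lemma mvGaussian_Iio_strictMono (m₁ m₂ : ℝ) {α β : ℝ}
    (hβ : -1 < β) (hαβ : β < α) (hα : α < 1) :
    mvGaussian ![m₁, m₂] !![1, β; β, 1] {w | w 0 < 0 ∧ w 1 < 0} <
      mvGaussian ![m₁, m₂] !![1, α; α, 1] {w | w 0 < 0 ∧ w 1 < 0} := by
  have hvα : 0 < 1 - α ^ 2 := by nlinarith
  have hvβ : 0 < 1 - β ^ 2 := by nlinarith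
  let z (ρ x : ℝ) : ℝ := (0 - (m₂ + ρ * (x - m₁))) / √(1 - ρ ^ 2)
  let f (ρ x : ℝ) : ENNReal := gaussianPDF m₁ 1 x * gaussianReal 0 1 (Set.Iio (z ρ x))
  have horthant {ρ : ℝ} (hρ : 0 < 1 - ρ ^ 2) :
      mvGaussian ![m₁, m₂] !![1, ρ; ρ, 1] {w | w 0 < 0 ∧ w 1 < 0} =
        ∫⁻ x in Set.Iio 0, f ρ x := by
    refine (mvGaussian_fin_two_apply m₁ m₂ hρ measurableSet_Iio measurableSet_Iio).trans ?_
    rw [setLIntegral_bivariateGaussianPDF _ _ hρ]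
    simp_rw [gaussianReal_Iio_eq_standard _ hρ]
    rfl
  have hmarginal {ρ : ℝ} (hρ : 0 < 1 - ρ ^ 2) :
      ∫⁻ x, f ρ x = gaussianReal m₂ 1 (Set.Iio 0) := by
    rw [← lintegral_gaussianPDF_mul_gaussianReal m₁ m₂ hρ]
    simp_rw [gaussianReal_Iio_eq_standard _ hρ]
    rfl
  have hmeas (ρ : ℝ) : Measurable (f ρ) :=
    (measurable_gaussianPDF _ _).mul
      (strictMono_gaussianReal_Iio.monotone.measurable.comp (by fun_prop))
  have hfin {ρ : ℝ} (hρ : 0 < 1 - ρ ^ 2) (s : Set ℝ) : ∫⁻ x in s, f ρ x ≠ ⊤ :=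
    ne_top_of_le_ne_top (by rw [hmarginal hρ]; exact measure_ne_top _ _)
      (setLIntegral_le_lintegral s _)
  have hf {ρ ρ' x : ℝ} (h : z ρ x < z ρ' x) : f ρ x < f ρ' x :=
    (ENNReal.mul_lt_mul_iff_right (gaussianPDF_pos _ one_ne_zero _).ne' gaussianPDF_ne_top).2
      (strictMono_gaussianReal_Iio h)
  have hz (x : ℝ) : z α x - z β x =
      z α 0 - z β 0 - (α / √(1 - α ^ 2) - β / √(1 - β ^ 2)) * x := by
    simp only [z]
    ring
  have hslope := sub_pos.2 (div_sqrt_one_sub_sq_lt hβ hαβ hα)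
  rw [horthant hvβ, horthant hvα]
  rcases le_or_gt (z β 0) (z α 0) with h0 | h0
  · refine setLIntegral_strict_mono measurableSet_Iio (by simp) (hmeas α) (hfin hvβ _) ?_
    refine ae_of_all _ fun x (hx : x < 0) ↦ hf ?_
    linarith [hz x, mul_neg_of_pos_of_neg hslope hx]
  · have hpos : ∫⁻ x in Set.Ici 0, f α x < ∫⁻ x in Set.Ici 0, f β x := by
      refine setLIntegral_strict_mono measurableSet_Ici (by simp) (hmeas β) (hfin hvα _) ?_
      refine ae_of_all _ fun x (hx : 0 ≤ x) ↦ hf ?_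
      linarith [hz x, mul_nonneg hslope.le hx]
    have hsum : (∫⁻ x in Set.Iio 0, f β x) + ∫⁻ x in Set.Ici 0, f β x =
        (∫⁻ x in Set.Iio 0, f α x) + ∫⁻ x in Set.Ici 0, f α x := by
      rw [← Set.compl_Iio, lintegral_add_compl _ measurableSet_Iio,
        lintegral_add_compl _ measurableSet_Iio, hmarginal hvα, hmarginal hvβ]
    by_contra! hle
    exact (ENNReal.add_lt_add_of_le_of_lt (hfin hvα _) hle hpos).ne hsum.symm

/-- **General-mean case of Theorem 2.** For bivariate Gaussians with common mean `μ`,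
unit variances and correlations `−1 < β < α < 1`, the `α`-model puts strictly more mass
on the negative orthant or on the positive orthant than the `β`-model; in particular
the binary distributions obtained by binarizing at `0` are different. -/
theorem general_mean_orthant_difference (μ₁ μ₂ α β : ℝ)
    (hβ : -1 < β) (hαβ : β < α) (hα : α < 1) :
    (mvGaussian ![μ₁, μ₂] !![1, β; β, 1] {w | w 0 < 0 ∧ w 1 < 0}
        < mvGaussian ![μ₁, μ₂] !![1, α; α, 1] {w | w 0 < 0 ∧ w 1 < 0} ∨
     mvGaussian ![μ₁, μ₂] !![1, β; β, 1] {w | 0 < w 0 ∧ 0 < w 1}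
        < mvGaussian ![μ₁, μ₂] !![1, α; α, 1] {w | 0 < w 0 ∧ 0 < w 1}) ∧
    ∃ x : Fin 2 → Bool,
      mvGaussian ![μ₁, μ₂] !![1, α; α, 1] (orthant x)
        ≠ mvGaussian ![μ₁, μ₂] !![1, β; β, 1] (orthant x) := by
  have hlt := mvGaussian_Iio_strictMono μ₁ μ₂ hβ hαβ hα
  refine ⟨Or.inl hlt, fun _ ↦ true, ?_⟩
  have horthant : orthant (fun _ : Fin 2 ↦ true) = {w | w 0 < 0 ∧ w 1 < 0} := by
    ext w
    simp [orthant, Fin.forall_fin_two]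
  rw [horthant]
  exact hlt.ne'
end
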